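/- Let G be a finite abelian group and let n ≥ 1 be a natural number. Then every element of the n-th group homology of G with trivial ℤ-coefficients is torsion: for every x ∈ Hₙ(G; ℤ) there exists a positive integer r with r • x = 0. -/

import Mathlib

/-- The differential of the unnormalized bar complex (inhomogeneous chains) of a group `G`
with trivial `ℤ`-coefficients, from degree `n + 1` to degree `n`: it sends the basis element
`[g₁|⋯|g_{n+1}]` to
`[g₂|⋯|g_{n+1}] + ∑_{i=1}^{n} (−1)^i [g₁|⋯|g_i g_{i+1}|⋯|g_{n+1}] + (−1)^{n+1} [g₁|⋯|g_n]`. -/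
noncomputable def barD (G : Type*) [Group G] (n : ℕ) :
    ((Fin (n + 1) → G) →₀ ℤ) →ₗ[ℤ] ((Fin n → G) →₀ ℤ) :=
  Finsupp.lsum ℤ fun g =>
    LinearMap.toSpanSingleton ℤ ((Fin n → G) →₀ ℤ)
      (Finsupp.single (fun i => g i.succ) 1
        + ∑ j : Fin (n + 1), ((-1 : ℤ) ^ ((j : ℕ) + 1)) •
            Finsupp.single (j.contractNth (· * ·) g) 1)

/-- The contracting homotopy (up to `|G|`): `[g₁|⋯|gₙ] ↦ ∑ₓ [x|g₁|⋯|gₙ]`. -/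
noncomputable def barH (G : Type*) [Fintype G] (n : ℕ) :
    ((Fin n → G) →₀ ℤ) →ₗ[ℤ] ((Fin (n + 1) → G) →₀ ℤ) :=
  Finsupp.lsum ℤ fun g =>
    LinearMap.toSpanSingleton ℤ ((Fin (n + 1) → G) →₀ ℤ)
      (∑ x : G, Finsupp.single (Fin.cons x g : Fin (n + 1) → G) 1)

theorem barH_single (G : Type*) [Fintype G] (n : ℕ) (g : Fin n → G) :
    barH G n (Finsupp.single g 1) =
      ∑ x : G, Finsupp.single (Fin.cons x g : Fin (n + 1) → G) 1 := by
  simp [barH]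

theorem barD_single (G : Type*) [Group G] (n : ℕ) (g : Fin (n + 1) → G) :
    barD G n (Finsupp.single g 1) = Finsupp.single (fun i => g i.succ) 1
        + ∑ j : Fin (n + 1), ((-1 : ℤ) ^ ((j : ℕ) + 1)) •
            Finsupp.single (j.contractNth (· * ·) g) 1 := by
  simp only [barD, Finsupp.lsum_single, LinearMap.toSpanSingleton_apply, one_smul]

theorem contractNth_zero_cons {G : Type*} [Group G] (m : ℕ) (x : G) (g : Fin (m + 1) → G) :
    (0 : Fin (m + 2)).contractNth (· * ·) (Fin.cons x g : Fin (m + 2) → G)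
      = Fin.cons (x * g 0) (fun i => g i.succ) := by
  funext k
  refine Fin.cases ?_ (fun i => ?_) k
  · simp [Fin.contractNth]
  · simp [Fin.contractNth]

theorem contractNth_succ_cons {G : Type*} [Group G] (m : ℕ) (j : Fin (m + 1)) (x : G)
    (g : Fin (m + 1) → G) :
    j.succ.contractNth (· * ·) (Fin.cons x g : Fin (m + 2) → G)
      = Fin.cons x (j.contractNth (· * ·) g) := by
  funext k
  refine Fin.cases ?_ (fun i => ?_) k
  · simp [Fin.contractNth]
  · simp [Fin.contractNth]

theorem barD_barH_single (G : Type*) [Group G] [Fintype G] (m : ℕ) (g : Fin (m + 1) → G) :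
    barD G (m + 1) (barH G (m + 1) (Finsupp.single g 1)) =
      (Fintype.card G : ℤ) • Finsupp.single g 1 - barH G m (barD G m (Finsupp.single g 1)) := by
  have key : ∑ x : G, (Finsupp.single
      (Fin.cons (x * g 0) (fun i => g i.succ) : Fin (m + 1) → G) (1 : ℤ))
      = ∑ x : G, Finsupp.single (Fin.cons x (fun i => g i.succ) : Fin (m + 1) → G) 1 :=
    Equiv.sum_comp (Equiv.mulRight (g 0))
      (fun x => Finsupp.single (Fin.cons x (fun i => g i.succ) : Fin (m + 1) → G) (1 : ℤ))
  rw [barH_single, map_sum, barD_single]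
  simp only [barD_single, map_add, map_sum, map_smul, barH_single]
  simp only [Fin.sum_univ_succ (n := m + 1), contractNth_zero_cons, contractNth_succ_cons,
    Fin.cons_succ, Finset.sum_add_distrib]
  rw [← Finset.smul_sum, key, Finset.sum_comm (s := (Finset.univ : Finset G))]
  simp only [← Finset.smul_sum, Fin.val_succ, pow_succ _ (_ + 1), Fin.val_zero]
  simp only [Finset.sum_const, Finset.card_univ, mul_neg, mul_one, neg_smul,
    Finset.sum_neg_distrib, zero_add, pow_one, one_smul, natCast_zsmul]
  abel

theorem barD_barH (G : Type*) [Group G] [Fintype G] (m : ℕ) (c : (Fin (m + 1) → G) →₀ ℤ) :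
    barD G (m + 1) (barH G (m + 1) c) =
      (Fintype.card G : ℤ) • c - barH G m (barD G m c) := by
  have : barD G (m + 1) ∘ₗ barH G (m + 1) =
      (Fintype.card G : ℤ) • LinearMap.id - barH G m ∘ₗ barD G m := by
    refine Finsupp.lhom_ext' fun g => LinearMap.ext_ring ?_
    exact barD_barH_single G m g
  exact LinearMap.congr_fun this c

/-- Let `G` be a finite abelian group and `n = m + 1 ≥ 1`. Every element of
the `n`-th group homology of `G` with trivial `ℤ`-coefficients — the quotient of the
`n`-cycles of the unnormalized bar complex by the `n`-boundaries — is torsion: for every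
`x ∈ Hₙ(G; ℤ)` there is a positive integer `r` with `r • x = 0`. -/
theorem groupHomology_torsion
    (G : Type*) [CommGroup G] [Fintype G] (m : ℕ)
    (x : ↥(LinearMap.ker (barD G m)) ⧸
      (LinearMap.range (barD G (m + 1))).comap (LinearMap.ker (barD G m)).subtype) :
    ∃ r : ℕ, 0 < r ∧ r • x = 0 := by
  obtain ⟨⟨c, hc⟩, rfl⟩ := Submodule.Quotient.mk_surjective _ x
  refine ⟨Fintype.card G, Fintype.card_pos, ?_⟩
  rw [← Submodule.Quotient.mk_smul, Submodule.Quotient.mk_eq_zero]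
  refine ⟨barH G (m + 1) c, ?_⟩
  rw [barD_barH, LinearMap.mem_ker.mp hc]
  simp
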